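/- Let n ≥ 3 be an integer and δ₀ ≥ n a constant. If h ∈ C²((0,∞)) satisfies the homogeneous equation h''(r) + ((n-1)/r)·h'(r) + (n(n+2)·U(r)^{4/(n-2)} − δ₀/r²)·h(r) = 0 for all r ∈ (0,∞) and lim_{r→0} h(r) = lim_{r→∞} h(r) = 0, then h ≡ 0 on (0,∞). -/

import Mathlib

open Set Filter

/-- The standard bubble `U(r) = (1 + r²)^{-(n-2)/2}`. -/
noncomputable def U (n : ℕ) (r : ℝ) : ℝ := (1 + r ^ 2) ^ (-(((n : ℝ) - 2) / 2))

/-- At a local maximum the second derivative is nonpositive. -/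
theorem IsLocalMax.deriv_deriv_nonpos {g : ℝ → ℝ} {x : ℝ} (hmax : IsLocalMax g x)
    (hc : ContinuousAt g x) : deriv (deriv g) x ≤ 0 := by
  by_contra! hpos
  have hmin : IsLocalMin g x := isLocalMin_of_deriv_deriv_pos hpos hmax.deriv_eq_zero hc
  have hconst : g =ᶠ[nhds x] fun _ => g x := by
    filter_upwards [hmax, hmin] with y h₁ h₂ using le_antisymm h₁ h₂
  have hzero := hconst.deriv.deriv_eq
  simp only [deriv_const'] at hzero
  exact hpos.ne' hzero

/-- A `C²` function on an open set has a first and a second derivative at each of its points. -/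
theorem ContDiffOn.differentiableAt_and_deriv {f : ℝ → ℝ} {s : Set ℝ} (hf : ContDiffOn ℝ 2 f s)
    (hs : IsOpen s) {x : ℝ} (hx : x ∈ s) :
    DifferentiableAt ℝ f x ∧ DifferentiableAt ℝ (deriv f) x := by
  have h₁ : ContDiffOn ℝ 1 (deriv f) s := hf.deriv_of_isOpen hs (by norm_num)
  exact ⟨(hf.differentiableOn (by norm_num)).differentiableAt (hs.mem_nhds hx),
    (h₁.differentiableOn (by norm_num)).differentiableAt (hs.mem_nhds hx)⟩

/-- Maximum principle on `(0,∞)`: if there is a strict supersolution bounded below by a positive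
constant, then a subsolution tending to `0` at both ends is nonpositive. -/
theorem nonpos_of_strict_supersolution {a b h w : ℝ → ℝ} {ε : ℝ} (hε : 0 < ε)
    (hh : ContDiffOn ℝ 2 h (Ioi 0)) (hw : ContDiffOn ℝ 2 w (Ioi 0))
    (hsub : ∀ r ∈ Ioi (0 : ℝ), 0 ≤ deriv (deriv h) r + a r * deriv h r + b r * h r)
    (hsup : ∀ r ∈ Ioi (0 : ℝ), deriv (deriv w) r + a r * deriv w r + b r * w r < 0)
    (hlow : ∀ r ∈ Ioi (0 : ℝ), ε ≤ w r)
    (h0 : Tendsto h (nhdsWithin 0 (Ioi 0)) (nhds 0)) (hinf : Tendsto h atTop (nhds 0)) :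
    ∀ r ∈ Ioi (0 : ℝ), h r ≤ 0 := by
  intro r₀ hr₀
  by_contra! hpos
  have hwpos : ∀ r ∈ Ioi (0 : ℝ), 0 < w r := fun r hr => hε.trans_le (hlow r hr)
  set q : ℝ := h r₀ / w r₀ with hq
  have hqpos : 0 < q := div_pos hpos (hwpos r₀ hr₀)
  have hsmall : ∀ r ∈ Ioi (0 : ℝ), h r < q * ε → h r / w r < q := fun r hr hlt => by
    rw [div_lt_iff₀ (hwpos r hr)]
    exact hlt.trans_le (mul_le_mul_of_nonneg_left (hlow r hr) hqpos.le)
  obtain ⟨α, hα, hα'⟩ := (mem_nhdsGT_iff_exists_Ioo_subset).1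
    (h0.eventually (gt_mem_nhds (mul_pos hqpos hε)))
  obtain ⟨β, hβ⟩ := eventually_atTop.1 (hinf.eventually (gt_mem_nhds (mul_pos hqpos hε)))
  have hmem : r₀ ∈ Icc α β := by
    constructor
    · by_contra! hlt
      exact (hsmall r₀ hr₀ (hα' ⟨hr₀, hlt⟩)).ne rfl
    · by_contra! hlt
      exact (hsmall r₀ hr₀ (hβ r₀ hlt.le)).ne rfl
  have hIcc : Icc α β ⊆ Ioi 0 := fun r hr => lt_of_lt_of_le hα hr.1
  have hcont : ContinuousOn (fun r => h r / w r) (Icc α β) :=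
    (hh.continuousOn.mono hIcc).div (hw.continuousOn.mono hIcc)
      fun r hr => (hwpos r (hIcc hr)).ne'
  obtain ⟨r₁, hr₁, hmax⟩ := isCompact_Icc.exists_isMaxOn ⟨r₀, hmem⟩ hcont
  have hr₁' : r₁ ∈ Ioi (0 : ℝ) := hIcc hr₁
  set M : ℝ := h r₁ / w r₁ with hM
  have hqM : q ≤ M := hmax hmem
  have hMpos : 0 < M := hqpos.trans_le hqM
  have hglobal : ∀ r ∈ Ioi (0 : ℝ), h r - M * w r ≤ 0 := by
    intro r hr
    have hle : h r / w r ≤ M := by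
      by_cases hmr : r ∈ Icc α β
      · exact hmax hmr
      · refine (hsmall r hr ?_).le.trans hqM
        rcases lt_or_ge r α with hlt | hge
        · exact hα' ⟨hr, hlt⟩
        · exact hβ r (not_le.1 fun hle => hmr ⟨hge, hle⟩).le
    rw [div_le_iff₀ (hwpos r hr)] at hle
    linarith
  have hval : h r₁ = M * w r₁ := (div_mul_cancel₀ _ (hwpos r₁ hr₁').ne').symm
  have hlocal : IsLocalMax (fun r => h r - M * w r) r₁ := by
    filter_upwards [isOpen_Ioi.mem_nhds hr₁'] with r hr
    simpa [hval] using hglobal r hr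
  have hderiv : ∀ r ∈ Ioi (0 : ℝ),
      HasDerivAt (fun r => h r - M * w r) (deriv h r - M * deriv w r) r := fun r hr =>
    (hh.differentiableAt_and_deriv isOpen_Ioi hr).1.hasDerivAt.sub
      ((hw.differentiableAt_and_deriv isOpen_Ioi hr).1.hasDerivAt.const_mul M)
  have hderiv₂ : deriv (deriv fun r => h r - M * w r) r₁
      = deriv (deriv h) r₁ - M * deriv (deriv w) r₁ := by
    have heq : (deriv fun r => h r - M * w r) =ᶠ[nhds r₁] fun r => deriv h r - M * deriv w r := by
      filter_upwards [isOpen_Ioi.mem_nhds hr₁'] with r hr using (hderiv r hr).deriv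
    rw [heq.deriv_eq]
    exact ((hh.differentiableAt_and_deriv isOpen_Ioi hr₁').2.hasDerivAt.sub
      ((hw.differentiableAt_and_deriv isOpen_Ioi hr₁').2.hasDerivAt.const_mul M)).deriv
  have hfirst : deriv h r₁ - M * deriv w r₁ = 0 :=
    (hderiv r₁ hr₁').deriv.symm.trans hlocal.deriv_eq_zero
  have hsecond := hlocal.deriv_deriv_nonpos (hderiv r₁ hr₁').continuousAt
  rw [hderiv₂] at hsecond
  have hsub₁ := hsub r₁ hr₁'
  have hsup₁ := mul_neg_of_pos_of_neg hMpos (hsup r₁ hr₁')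
  rw [hval, sub_eq_zero.1 hfirst] at hsub₁
  linarith

/-- The potential `U^{4/(n-2)}` equals `(1 + r²)⁻²`. -/
theorem U_rpow_four_div {n : ℕ} (hn : 3 ≤ n) (r : ℝ) :
    U n r ^ ((4 : ℝ) / ((n : ℝ) - 2)) = ((1 + r ^ 2) ^ 2)⁻¹ := by
  have hn' : (3 : ℝ) ≤ n := by exact_mod_cast hn
  have hne : (n : ℝ) - 2 ≠ 0 := by linarith
  have hexp : -(((n : ℝ) - 2) / 2) * (4 / ((n : ℝ) - 2)) = -(2 : ℕ) := by
    push_cast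
    field_simp
    norm_num
  rw [U, ← Real.rpow_mul (by positivity), hexp, Real.rpow_neg (by positivity), Real.rpow_natCast]

/-- The function `ε + r (1 + r²)^p`; for `p = -n/2` its second summand is, up to a constant factor,
the derivative of the bubble. -/
noncomputable def barrier (ε p r : ℝ) : ℝ := ε + r * (1 + r ^ 2) ^ p

theorem hasDerivAt_one_add_sq_rpow (p r : ℝ) :
    HasDerivAt (fun r : ℝ => (1 + r ^ 2) ^ p) (2 * p * r * (1 + r ^ 2) ^ (p - 1)) r := by
  have h₁ : HasDerivAt (fun r : ℝ => 1 + r ^ 2) (2 * r) r := by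
    simpa using (hasDerivAt_pow 2 r).const_add 1
  convert h₁.rpow_const (p := p) (Or.inl (by positivity)) using 1
  ring

theorem contDiff_barrier (ε p : ℝ) : ContDiff ℝ 2 (barrier ε p) := by
  unfold barrier
  refine contDiff_const.add (contDiff_id.mul ?_)
  exact (contDiff_const.add (contDiff_id.pow 2)).rpow_const_of_ne fun r => by
    simp only [id]
    positivity

theorem deriv_barrier (ε p : ℝ) : deriv (barrier ε p) =
    fun r => (1 + r ^ 2) ^ p + 2 * p * r ^ 2 * (1 + r ^ 2) ^ (p - 1) := by
  funext r
  have h₁ := ((hasDerivAt_id r).mul (hasDerivAt_one_add_sq_rpow p r)).const_add ε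
  refine (h₁.congr_deriv ?_).deriv
  simp only [id]
  ring

theorem deriv_deriv_barrier (ε p r : ℝ) : deriv (deriv (barrier ε p)) r =
    6 * p * r * (1 + r ^ 2) ^ (p - 1) + 4 * p * (p - 1) * r ^ 3 * (1 + r ^ 2) ^ (p - 2) := by
  rw [deriv_barrier]
  have h₁ := (hasDerivAt_one_add_sq_rpow p r).add
    (((hasDerivAt_pow 2 r).const_mul (2 * p)).mul (hasDerivAt_one_add_sq_rpow (p - 1) r))
  refine (h₁.congr_deriv ?_).deriv
  rw [show p - 1 - 1 = p - 2 by ring]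
  push_cast
  ring

/-- The linearized operator applied to the barrier with exponent `-N/2`. -/
theorem linearized_barrier (N δ ε : ℝ) {r : ℝ} (hr : 0 < r) :
    deriv (deriv (barrier ε (-(N / 2)))) r + (N - 1) / r * deriv (barrier ε (-(N / 2))) r +
        (N * (N + 2) * ((1 + r ^ 2) ^ 2)⁻¹ - δ / r ^ 2) * barrier ε (-(N / 2)) r =
      (ε * (N * (N + 2) * (r ^ 2 / (1 + r ^ 2) ^ 2) - δ)
        - (δ - N + 1) * (r * (1 + r ^ 2) ^ (-(N / 2)))) / r ^ 2 := by
  have hpos : (0 : ℝ) < 1 + r ^ 2 := by positivity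
  rw [deriv_deriv_barrier, deriv_barrier, barrier]
  beta_reduce
  have h₁ : (1 + r ^ 2) ^ (-(N / 2) - 1) = (1 + r ^ 2) ^ (-(N / 2)) / (1 + r ^ 2) := by
    rw [Real.rpow_sub hpos, Real.rpow_one]
  have h₂ : (1 + r ^ 2) ^ (-(N / 2) - 2) = (1 + r ^ 2) ^ (-(N / 2)) / (1 + r ^ 2) ^ 2 := by
    rw [Real.rpow_sub hpos, Real.rpow_two]
  rw [h₁, h₂]
  generalize (1 + r ^ 2) ^ (-(N / 2)) = A
  field_simp
  ring

/-- For a suitable `ε > 0` the barrier is a strict supersolution. -/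
theorem exists_barrier_supersolution {N δ : ℝ} (hN : 0 < N) (hδ : N ≤ δ) :
    ∃ ε > 0, ∀ r ∈ Ioi (0 : ℝ),
      deriv (deriv (barrier ε (-(N / 2)))) r + (N - 1) / r * deriv (barrier ε (-(N / 2))) r +
        (N * (N + 2) * ((1 + r ^ 2) ^ 2)⁻¹ - δ / r ^ 2) * barrier ε (-(N / 2)) r < 0 := by
  set c : ℝ := 1 / (N + 2) * (N + 2) ^ (-(N / 2)) with hc
  have hcpos : 0 < c := by positivity
  refine ⟨c / (N * (N + 2)), by positivity, fun r hr => ?_⟩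
  have hr : 0 < r := hr
  rw [linearized_barrier N δ _ hr]
  refine div_neg_of_neg_of_pos ?_ (by positivity)
  set ε : ℝ := c / (N * (N + 2)) with hε
  have hεpos : 0 < ε := by positivity
  have hεc : ε * (N * (N + 2)) = c := div_mul_cancel₀ _ (by positivity)
  set s : ℝ := r ^ 2 / (1 + r ^ 2) ^ 2 with hs
  set Z : ℝ := r * (1 + r ^ 2) ^ (-(N / 2)) with hZ
  have hZpos : 0 < Z := by positivity
  have hδZ : Z ≤ (δ - N + 1) * Z := le_mul_of_one_le_left hZpos.le (by linarith)
  have hεδ : ε * N ≤ ε * δ := mul_le_mul_of_nonneg_left hδ hεpos.le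
  have hεN : 0 < ε * N := by positivity
  suffices hkey : ε * (N * (N + 2)) * s - ε * N < Z by linarith
  rcases le_or_gt ((N + 2) * s) 1 with hle | hgt
  · have := mul_le_mul_of_nonneg_left hle hεN.le
    linarith
  · have hs1 : s ≤ 1 := by
      rw [hs, div_le_one (by positivity)]
      nlinarith [sq_nonneg r, sq_nonneg (r ^ 2)]
    have hlt : (1 + r ^ 2) ^ 2 < (N + 2) * r ^ 2 := by
      rwa [hs, ← mul_div_assoc, one_lt_div (by positivity)] at hgt
    have hup : 1 + r ^ 2 ≤ N + 2 := by
      by_contra! hcon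
      nlinarith [mul_pos (sub_pos.2 hcon) (show 0 < 1 + r ^ 2 by positivity)]
    have hrlow : 1 / (N + 2) ≤ r := by
      rw [div_le_iff₀ (by positivity)]
      by_contra! hcon
      rcases le_or_gt r 1 with h1 | h1
      · nlinarith [sq_nonneg (r ^ 2), mul_le_mul_of_nonneg_right hcon.le hr.le, sq_nonneg r]
      · nlinarith
    have hcZ : c ≤ Z :=
      mul_le_mul hrlow
        (Real.rpow_le_rpow_of_nonpos (by positivity) hup (by linarith))
        (by positivity) hr.le
    rw [hεc]
    have := mul_le_mul_of_nonneg_left hs1 hcpos.le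
    linarith

/-- a `C²` solution of the homogeneous equation
`h'' + ((n-1)/r) h' + (n(n+2) U^{4/(n-2)} − δ₀/r²) h = 0` on `(0,∞)` that tends
to `0` both as `r → 0⁺` and as `r → ∞` vanishes identically on `(0,∞)`. -/
theorem statement2 (n : ℕ) (hn : 3 ≤ n) (δ₀ : ℝ) (hδ₀ : (n : ℝ) ≤ δ₀)
    (h : ℝ → ℝ) (hreg : ContDiffOn ℝ 2 h (Ioi 0))
    (heq : ∀ r ∈ Ioi (0 : ℝ),
      deriv (deriv h) r + ((n : ℝ) - 1) / r * deriv h r +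
        ((n : ℝ) * ((n : ℝ) + 2) * U n r ^ ((4 : ℝ) / ((n : ℝ) - 2)) - δ₀ / r ^ 2) * h r
        = 0)
    (h0 : Tendsto h (nhdsWithin 0 (Ioi 0)) (nhds 0))
    (hinf : Tendsto h atTop (nhds 0)) :
    ∀ r ∈ Ioi (0 : ℝ), h r = 0 := by
  have hN : (0 : ℝ) < n := by exact_mod_cast (by omega : 0 < n)
  simp only [U_rpow_four_div hn] at heq
  obtain ⟨ε, hε, hsup⟩ := exists_barrier_supersolution hN hδ₀
  have hlow : ∀ r ∈ Ioi (0 : ℝ), ε ≤ barrier ε (-((n : ℝ) / 2)) r := fun r hr => by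
    have hr : 0 < r := hr
    exact le_add_of_nonneg_right (by positivity)
  have hw := (contDiff_barrier ε (-((n : ℝ) / 2))).contDiffOn (s := Ioi 0)
  intro r hr
  refine le_antisymm ?_ (neg_nonpos.1 ?_)
  · exact nonpos_of_strict_supersolution hε hreg hw (fun r hr => (heq r hr).ge) hsup hlow
      h0 hinf r hr
  · refine nonpos_of_strict_supersolution (h := fun r => -h r) hε hreg.neg hw (fun r hr => ?_)
      hsup hlow (by simpa using h0.neg) (by simpa using hinf.neg) r hr
    simp only [deriv.fun_neg', deriv.fun_neg]
    linarith [heq r hr]
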